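/- For every φ ∈ C_c(ℝ) and every x ∈ ℝ, one has |∫_ℝ φ(t) e^{−i(x + i ln ρ(S))t} dt| ≤ ‖M_φ‖ and |∫_ℝ φ(t) e^{−i(x − i ln ρ(S⁻¹))t} dt| ≤ ‖M_φ‖; that is, the bound |φ̂(z)| ≤ ‖M_φ‖ holds on the two boundary lines Im z = ln ρ(S) and Im z = −ln ρ(S⁻¹) of the strip Ω. -/

import Mathlib

open MeasureTheory Complex Real Filter Topology

noncomputable section

/-- A Hilbert space `H` of (locally integrable) functions on `ℝ` satisfying the
hypotheses (H1)-(H4) of the paper. -/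
structure MultiplierSetup (H : Type) [NormedAddCommGroup H]
    [InnerProductSpace ℂ H] [CompleteSpace H] where
  /-- the inclusion of `H` into (a.e. classes of) functions on `ℝ` -/
  ι : H →ₗ[ℂ] (ℝ →ₘ[volume] ℂ)
  ι_inj : Function.Injective ι
  /-- `H ⊆ L¹_loc(ℝ)` -/
  locInt : ∀ f : H, LocallyIntegrable (ι f) volume
  /-- `C_c(ℝ) ⊆ H` -/
  ofCc : CompactlySupportedContinuousMap ℝ ℂ → H
  ofCc_spec : ∀ φ : CompactlySupportedContinuousMap ℝ ℂ,
    (ι (ofCc φ) : ℝ → ℂ) =ᵐ[volume] φ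
  /-- `C_c(ℝ)` is dense in `H` -/
  ofCc_dense : DenseRange ofCc
  /-- (H1): both inclusions are continuous -/
  incl_cont : ∀ K : Set ℝ, IsCompact K → ∃ c > 0,
    (∀ φ : CompactlySupportedContinuousMap ℝ ℂ, tsupport (φ : ℝ → ℂ) ⊆ K →
      ‖ofCc φ‖ ≤ c * ⨆ x, ‖φ x‖) ∧
    (∀ f : H, (∫ x in K, ‖(ι f : ℝ → ℂ) x‖) ≤ c * ‖f‖)
  /-- (H2): the translation group acting boundedly on `H` -/
  S : ℝ → H →L[ℂ] H
  S_spec : ∀ (x : ℝ) (f : H), ((ι (S x f)) : ℝ → ℂ) =ᵐ[volume]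
    fun y => (ι f : ℝ → ℂ) (y - x)
  S_add : ∀ x y : ℝ, (S x).comp (S y) = S (x + y)
  S_zero : S 0 = 1
  S_loc_bdd : ∀ K : Set ℝ, IsCompact K → ∃ C : ℝ, ∀ x ∈ K, ‖S x‖ ≤ C
  /-- (H3): the modulations act on `H`, uniformly boundedly -/
  T : ℝ → H →L[ℂ] H
  T_spec : ∀ (α : ℝ) (f : H), ((ι (T α f)) : ℝ → ℂ) =ᵐ[volume]
    fun x => Complex.exp (Complex.I * α * x) * (ι f : ℝ → ℂ) x
  T_bdd : ∃ C : ℝ, ∀ α : ℝ, ‖T α‖ ≤ C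
  /-- (H4): exponential bound on the norms of the translations -/
  S_exp : ∃ C > 0, ∃ a ≥ 0, ∀ x : ℝ, ‖S x‖ ≤ C * Real.exp (a * |x|)

open FourierTransform in
theorem tendsto_integral_gaussian_smul_fourier {a : ℝ → ℂ} (hf : Integrable a)
    (h0 : ContinuousAt a 0) :
    Tendsto (fun c : ℝ => ∫ w : ℝ, cexp (-c⁻¹ * ‖w‖ ^ 2) • 𝓕 a w) atTop (𝓝 (a 0)) := by
  refine (Real.tendsto_integral_gaussian_smul' hf h0).congr' ?_
  filter_upwards [Ioi_mem_atTop 0] with c (hc : 0 < c)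
  have J : Integrable (fun w : ℝ ↦ cexp (-c⁻¹ * ‖w‖ ^ 2 + 2 * π * I * inner ℝ (0 : ℝ) w)) :=
    GaussianFourier.integrable_cexp_neg_mul_sq_norm_add (by simpa) _ _
  have key := VectorFourier.integral_fourierIntegral_smul_eq_flip (L := innerₗ ℝ)
      Real.continuous_fourierChar continuous_inner J hf
  have e1 : ∀ w : ℝ, VectorFourier.fourierIntegral Real.fourierChar volume (innerₗ ℝ)
      (fun w : ℝ ↦ cexp (-c⁻¹ * ‖w‖ ^ 2 + 2 * π * I * inner ℝ (0 : ℝ) w)) w =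
      𝓕 (fun w : ℝ ↦ cexp (-c⁻¹ * ‖w‖ ^ 2 + 2 * π * I * inner ℝ (0 : ℝ) w)) w := fun w => rfl
  simp_rw [e1] at key
  have e2 : ∀ w : ℝ, 𝓕 (fun w : ℝ ↦ cexp (-c⁻¹ * ‖w‖ ^ 2 + 2 * π * I * inner ℝ (0 : ℝ) w)) w =
      (π * c : ℂ) ^ (Module.finrank ℝ ℝ / 2 : ℂ) * cexp (-π ^ 2 * c * ‖0 - w‖ ^ 2) := by
    intro w
    rw [show (fun w : ℝ ↦ cexp (-c⁻¹ * ‖w‖ ^ 2 + 2 * π * I * inner ℝ (0 : ℝ) w)) =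
      fun w : ℝ ↦ cexp (-((c⁻¹ : ℝ) : ℂ) * ‖w‖ ^ 2 + 2 * π * I * inner ℝ (0 : ℝ) w) by simp,
      fourier_gaussian_innerProductSpace' (by simpa)]
    congr
    · simp
    · simp; ring
  simp_rw [e2] at key
  rw [key]
  congr 1
  ext w
  congr 1
  · simp
  · rw [flip_innerₗ]
    rfl

open FourierTransform in
theorem fourier_autocorrelation {H : Type*} [NormedAddCommGroup H] [InnerProductSpace ℂ H]
    [CompleteSpace H] {F : ℝ → H} (hF : Continuous F) (hc : HasCompactSupport F) (v : ℝ) :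
    𝓕 (fun u => ∫ s : ℝ, inner ℂ (F s) (F (s + u))) v = ((‖𝓕 F v‖ ^ 2 : ℝ) : ℂ) := by
  have hFi : Integrable F := hF.integrable_of_hasCompactSupport hc
  have hcont : Continuous fun t : ℝ => cexp (↑(-2 * π * t * v) * I) := by fun_prop
  have hGi : Integrable fun t : ℝ => cexp (↑(-2 * π * t * v) * I) • F t :=
    (hcont.smul hF).integrable_of_hasCompactSupport hc.smul_left
  rw [Real.fourier_real_eq_integral_exp_smul]
  have h1 : ∀ u : ℝ, cexp (↑(-2 * π * u * v) * I) • (∫ s : ℝ, inner ℂ (F s) (F (s + u))) =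
      ∫ s : ℝ, cexp (↑(-2 * π * u * v) * I) • inner ℂ (F s) (F (s + u)) :=
    fun u => (integral_smul _ _).symm
  simp_rw [h1]
  rw [integral_integral_swap_of_hasCompactSupport]
  · have h2 : ∀ s : ℝ, (∫ u : ℝ, cexp (↑(-2 * π * u * v) * I) • inner ℂ (F s) (F (s + u))) =
        inner ℂ (cexp (↑(-2 * π * s * v) * I) • F s) (𝓕 F v) := by
      intro s
      rw [Real.fourier_real_eq_integral_exp_smul, ← integral_inner hGi]
      refine Eq.trans ?_ (integral_add_left_eq_self _ s)
      congr 1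
      ext u
      rw [inner_smul_left, inner_smul_right, ← Complex.exp_conj, ← mul_assoc, ← Complex.exp_add,
        smul_eq_mul, map_mul, Complex.conj_ofReal, Complex.conj_I]
      congr 2
      push_cast
      ring
    simp_rw [h2]
    have h3 := integral_inner (𝕜 := ℂ) hGi (𝓕 F v)
    have h4 : ∀ s : ℝ, inner ℂ (cexp (↑(-2 * π * s * v) * I) • F s) (𝓕 F v) =
        (starRingEnd ℂ) (inner ℂ (𝓕 F v) (cexp (↑(-2 * π * s * v) * I) • F s)) :=
      fun s => (inner_conj_symm _ _).symm
    simp_rw [h4]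
    rw [integral_conj, h3, ← Real.fourier_real_eq_integral_exp_smul, inner_conj_symm,
      inner_self_eq_norm_sq_to_K]
    simp
  · simp only [Function.uncurry_def]
    fun_prop
  · refine HasCompactSupport.intro (K := (fun p : ℝ × ℝ => (p.2 - p.1, p.1)) ''
      (tsupport F ×ˢ tsupport F)) ((hc.isCompact.prod hc.isCompact).image (by fun_prop)) ?_
    rintro ⟨u, s⟩ hn
    simp only [Function.uncurry_apply_pair]
    by_contra hne
    apply hn
    refine ⟨(s, s + u), ⟨?_, ?_⟩, by simp⟩
    · apply subset_tsupport
      intro h0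
      simp [h0] at hne
    · apply subset_tsupport
      intro h0
      simp only at h0
      simp [h0] at hne

theorem continuous_autocorrelation {H : Type*} [NormedAddCommGroup H] [InnerProductSpace ℂ H]
    {F : ℝ → H} (hF : Continuous F) (hc : HasCompactSupport F) :
    Continuous (fun u => ∫ s : ℝ, inner ℂ (F s) (F (s + u))) := by
  have h : ∀ u, (∫ s : ℝ, inner ℂ (F s) (F (s + u))) =
      ∫ s in tsupport F, inner ℂ (F s) (F (s + u)) := by
    intro u
    refine (setIntegral_eq_integral_of_forall_compl_eq_zero fun s hs => ?_).symm
    rw [image_eq_zero_of_notMem_tsupport hs, inner_zero_left]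
  simp_rw [h]
  exact continuous_parametric_integral_of_continuous (by fun_prop) hc.isCompact

theorem hasCompactSupport_autocorrelation {H : Type*} [NormedAddCommGroup H]
    [InnerProductSpace ℂ H] {F : ℝ → H} (hc : HasCompactSupport F) :
    HasCompactSupport (fun u => ∫ s : ℝ, inner ℂ (F s) (F (s + u))) := by
  refine HasCompactSupport.intro (K := (fun p : ℝ × ℝ => p.2 - p.1) ''
      (tsupport F ×ˢ tsupport F)) ((hc.isCompact.prod hc.isCompact).image (by fun_prop)) ?_
  intro u hu
  refine integral_eq_zero_of_ae (Eventually.of_forall fun s => ?_)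
  simp only [Pi.zero_apply]
  by_contra hne
  apply hu
  refine ⟨(s, s + u), ⟨?_, ?_⟩, by simp⟩
  · apply subset_tsupport
    intro h0
    simp [h0] at hne
  · apply subset_tsupport
    intro h0
    simp only at h0
    simp [h0] at hne

open FourierTransform in
theorem tendsto_integral_gaussian_norm_sq_fourier {H : Type*} [NormedAddCommGroup H]
    [InnerProductSpace ℂ H] [CompleteSpace H] {F : ℝ → H} (hF : Continuous F)
    (hc : HasCompactSupport F) :
    Tendsto (fun c : ℝ => ∫ w : ℝ, Real.exp (-c⁻¹ * ‖w‖ ^ 2) * ‖𝓕 F w‖ ^ 2) atTop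
      (𝓝 (∫ s : ℝ, ‖F s‖ ^ 2)) := by
  have h := tendsto_integral_gaussian_smul_fourier
    ((continuous_autocorrelation hF hc).integrable_of_hasCompactSupport
      (hasCompactSupport_autocorrelation hc)) (continuous_autocorrelation hF hc).continuousAt
  simp_rw [fourier_autocorrelation hF hc] at h
  have h' := (Complex.continuous_re.tendsto _).comp h
  convert h' using 2 with c
  · rw [Function.comp_apply, ← Complex.ofReal_re (∫ w : ℝ, _), ← integral_complex_ofReal]
    congr 2
    ext w
    push_cast
    rfl
  · rw [← Complex.ofReal_re (∫ w : ℝ, _), ← integral_complex_ofReal]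
    congr 2
    ext w
    simp [inner_self_eq_norm_sq_to_K]

open FourierTransform in
/-- A pointwise comparison of Fourier transforms gives a comparison of `L²` norms. -/
theorem integral_norm_sq_le_of_norm_fourier_le {H : Type*} [NormedAddCommGroup H]
    [InnerProductSpace ℂ H] [CompleteSpace H] {F Q : ℝ → H} (hF : Continuous F)
    (hFc : HasCompactSupport F) (hQ : Continuous Q) (hQc : HasCompactSupport Q)
    {δ : ℝ} (hδ : 0 ≤ δ) (h : ∀ v, δ * ‖𝓕 F v‖ ≤ ‖𝓕 Q v‖) :
    δ ^ 2 * ∫ s : ℝ, ‖F s‖ ^ 2 ≤ ∫ s : ℝ, ‖Q s‖ ^ 2 := by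
  refine le_of_tendsto_of_tendsto ((tendsto_integral_gaussian_norm_sq_fourier hF hFc).const_mul _)
    (tendsto_integral_gaussian_norm_sq_fourier hQ hQc) ?_
  filter_upwards [Ioi_mem_atTop 0] with c (hc : 0 < c)
  have hint : ∀ {G : ℝ → H}, Continuous G → HasCompactSupport G →
      Integrable fun w : ℝ => Real.exp (-c⁻¹ * ‖w‖ ^ 2) * ‖𝓕 G w‖ ^ 2 := by
    intro G hG hGc
    have hGi : Integrable G := hG.integrable_of_hasCompactSupport hGc
    have hcont : Continuous (𝓕 G) := by
      have := VectorFourier.fourierIntegral_continuous (L := innerₗ ℝ)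
        Real.continuous_fourierChar continuous_inner hGi
      exact this
    have hb : ∀ w, ‖𝓕 G w‖ ≤ ∫ v, ‖G v‖ := fun w =>
      VectorFourier.norm_fourierIntegral_le_integral_norm _ _ _ _ _
    have hg : Integrable fun w : ℝ => Real.exp (-c⁻¹ * ‖w‖ ^ 2) := by
      simpa using integrable_exp_neg_mul_sq (b := c⁻¹) (by positivity)
    refine hg.mul_bdd (c := (∫ v, ‖G v‖) ^ 2) (by fun_prop) (Eventually.of_forall fun w => ?_)
    rw [norm_pow, norm_norm]
    gcongr
    exact hb w
  rw [← integral_const_mul]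
  refine integral_mono ((hint hF hFc).const_mul _) (hint hQ hQc) fun w => ?_
  have := pow_le_pow_left₀ (by positivity) (h w) 2
  calc δ ^ 2 * (Real.exp (-c⁻¹ * ‖w‖ ^ 2) * ‖𝓕 F w‖ ^ 2)
      = Real.exp (-c⁻¹ * ‖w‖ ^ 2) * (δ * ‖𝓕 F w‖) ^ 2 := by ring
    _ ≤ _ := by gcongr

/-- A nonzero point of the spectrum of maximal modulus is an approximate eigenvalue. -/
theorem exists_norm_sub_smul_lt_of_norm_eq_spectralRadius {E : Type*} [NormedAddCommGroup E]
    [NormedSpace ℂ E] [CompleteSpace E] {A : E →L[ℂ] E} {z : ℂ} (hz0 : z ≠ 0)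
    (hz : z ∈ spectrum ℂ A) (hzr : (‖z‖₊ : ENNReal) = spectralRadius ℂ A) {ε : ℝ} (hε : 0 < ε) :
    ∃ f : E, ‖A f - z • f‖ < ε * ‖f‖ := by
  by_contra! hcon
  obtain ⟨η, hη0, hη⟩ : ∃ η : ℝ, 0 < η ∧ η * ‖z‖ < ε / 2 :=
    ⟨ε / (4 * ‖z‖), by positivity, by
      have : ‖z‖ ≠ 0 := by simpa using hz0
      field_simp
      norm_num⟩
  set l : ℂ := ((1 + η : ℝ) : ℂ) * z with hl
  have hlz : ‖l - z‖ < ε / 2 := by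
    have : l - z = (η : ℂ) * z := by rw [hl]; push_cast; ring
    rw [this, norm_mul, Complex.norm_real, Real.norm_of_nonneg hη0.le]
    exact hη
  have hlr : spectralRadius ℂ A < ‖l‖₊ := by
    rw [← hzr, ENNReal.coe_lt_coe, ← NNReal.coe_lt_coe, coe_nnnorm, coe_nnnorm, hl, norm_mul,
      Complex.norm_real, Real.norm_of_nonneg (by positivity)]
    have : 0 < ‖z‖ := by simpa using hz0
    nlinarith
  obtain ⟨u, hu⟩ := spectrum.mem_resolventSet_of_spectralRadius_lt hlr
  have hinv : ‖(↑u⁻¹ : E →L[ℂ] E)‖ ≤ 2 / ε := by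
    refine ContinuousLinearMap.opNorm_le_bound _ (by positivity) fun y => ?_
    set f := (↑u⁻¹ : E →L[ℂ] E) y with hf
    have h1 : (u : E →L[ℂ] E) f = y := by
      rw [hf, ← mul_apply_eq_comp, Units.mul_inv, one_apply_eq_self]
    rw [hu] at h1
    have h2 : l • f - A f = y := by simpa [Algebra.algebraMap_eq_smul_one] using h1
    have h3 : ‖A f - z • f‖ ≤ ‖y‖ + ε / 2 * ‖f‖ := by
      have : A f - z • f = -y + (l - z) • f := by rw [← h2, sub_smul]; abel
      rw [this]
      refine (norm_add_le _ _).trans ?_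
      rw [norm_neg, norm_smul]
      gcongr
    have h4 := hcon f
    rw [div_mul_eq_mul_div, le_div_iff₀ hε]
    linarith
  have hne : (0 : ℝ) < ‖(↑u⁻¹ : E →L[ℂ] E)‖ := by
    rcases subsingleton_or_nontrivial (E →L[ℂ] E) with h | h
    · exact absurd hz (by rw [spectrum.of_subsingleton]; simp)
    · exact norm_pos_iff.2 u⁻¹.ne_zero
  refine hz ?_
  refine (u.ofNearby (algebraMap ℂ (E →L[ℂ] E) z - A) ?_).isUnit
  have h1 : algebraMap ℂ (E →L[ℂ] E) z - A - u = (z - l) • (1 : E →L[ℂ] E) := by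
    rw [hu, Algebra.algebraMap_eq_smul_one, Algebra.algebraMap_eq_smul_one, sub_smul]
    abel
  have h2 : ε / 2 ≤ ‖(↑u⁻¹ : E →L[ℂ] E)‖⁻¹ := by
    rw [le_inv_comm₀ (by positivity) hne, inv_div]
    exact hinv
  calc _ = ‖z - l‖ * ‖(1 : E →L[ℂ] E)‖ := by rw [h1, norm_smul]
    _ ≤ ‖z - l‖ * 1 := by
      gcongr
      exact ContinuousLinearMap.norm_id_le
    _ < ε / 2 := by rwa [mul_one, norm_sub_rev]
    _ ≤ _ := h2

/-- Translation by `s` on compactly supported continuous functions. -/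
def CompactlySupportedContinuousMap.translate (s : ℝ) (g : CompactlySupportedContinuousMap ℝ ℂ) :
    CompactlySupportedContinuousMap ℝ ℂ where
  toFun y := g (y - s)
  continuous_toFun := by fun_prop
  hasCompactSupport' := g.hasCompactSupport.comp_homeomorph (Homeomorph.subRight s)

@[simp]
theorem CompactlySupportedContinuousMap.translate_apply (s : ℝ)
    (g : CompactlySupportedContinuousMap ℝ ℂ) (y : ℝ) : g.translate s y = g (y - s) := rfl

namespace MultiplierSetup

variable {H : Type} [NormedAddCommGroup H] [InnerProductSpace ℂ H] [CompleteSpace H]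
  (P : MultiplierSetup H)

theorem ext_of_ae {f g : H} (h : (P.ι f : ℝ → ℂ) =ᵐ[volume] P.ι g) : f = g :=
  P.ι_inj (AEEqFun.ext h)

theorem ofCc_sub (f g : CompactlySupportedContinuousMap ℝ ℂ) :
    P.ofCc (f - g) = P.ofCc f - P.ofCc g := by
  apply P.ext_of_ae
  rw [map_sub]
  filter_upwards [P.ofCc_spec f, P.ofCc_spec g, P.ofCc_spec (f - g),
    AEEqFun.coeFn_sub (P.ι (P.ofCc f)) (P.ι (P.ofCc g))] with x h1 h2 h3 h4
  simp [h1, h2, h3, h4]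

theorem S_ofCc (s : ℝ) (g : CompactlySupportedContinuousMap ℝ ℂ) :
    P.S s (P.ofCc g) = P.ofCc (g.translate s) := by
  apply P.ext_of_ae
  filter_upwards [P.S_spec s (P.ofCc g), P.ofCc_spec (g.translate s),
    (measurePreserving_sub_right volume s).quasiMeasurePreserving.ae_eq (P.ofCc_spec g)]
    with x h1 h2 h3
  rw [h1, h2]
  exact h3

theorem S_S_apply (s t : ℝ) (f : H) : P.S s (P.S t f) = P.S (s + t) f := by
  rw [← P.S_add]; rfl

theorem continuous_S_ofCc (g : CompactlySupportedContinuousMap ℝ ℂ) :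
    Continuous fun s => P.S s (P.ofCc g) := by
  rw [Metric.continuous_iff]
  intro s₀ ε hε
  set K : Set ℝ := (fun p : ℝ × ℝ => p.1 + p.2) '' (tsupport g ×ˢ Set.Icc (s₀ - 1) (s₀ + 1))
  have hK : IsCompact K := (g.hasCompactSupport.isCompact.prod isCompact_Icc).image (by fun_prop)
  obtain ⟨c, hc, hcK, -⟩ := P.incl_cont K hK
  have hu : UniformContinuous g := g.hasCompactSupport.uniformContinuous_of_continuous g.continuous
  rw [Metric.uniformContinuous_iff] at hu
  obtain ⟨η, hη, hg⟩ := hu (ε / (2 * c)) (by positivity)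
  refine ⟨min η 1, by positivity, fun s hs => ?_⟩
  rw [dist_eq_norm, P.S_ofCc, P.S_ofCc, ← P.ofCc_sub]
  have hs1 : |s - s₀| < η := lt_of_lt_of_le hs (min_le_left _ _)
  have hs2 : |s - s₀| < 1 := lt_of_lt_of_le hs (min_le_right _ _)
  have hsupp : tsupport (g.translate s - g.translate s₀ : CompactlySupportedContinuousMap ℝ ℂ)
      ⊆ K := by
    refine closure_minimal (fun y hy => ?_) hK.isClosed
    rw [Function.mem_support] at hy
    have : g (y - s) ≠ 0 ∨ g (y - s₀) ≠ 0 := by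
      by_contra! h
      exact hy (by simp [h.1, h.2])
    rw [abs_lt] at hs2
    rcases this with h | h
    · exact ⟨(y - s, s), ⟨subset_tsupport _ h, by constructor <;> linarith⟩, by simp⟩
    · exact ⟨(y - s₀, s₀), ⟨subset_tsupport _ h, by constructor <;> linarith⟩, by simp⟩
  have hsup : (⨆ x, ‖(g.translate s - g.translate s₀ : CompactlySupportedContinuousMap ℝ ℂ) x‖)
      ≤ ε / (2 * c) := by
    refine ciSup_le fun x => ?_
    have := hg (a := x - s) (b := x - s₀) (by
      rw [Real.dist_eq, show x - s - (x - s₀) = -(s - s₀) by ring, abs_neg]; exact hs1)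
    rw [dist_eq_norm] at this
    simpa using this.le
  calc _ ≤ c * (ε / (2 * c)) := (hcK _ hsupp).trans (by gcongr)
    _ = ε / 2 := by field_simp
    _ < ε := by linarith

theorem continuous_S_apply (f : H) : Continuous fun s => P.S s f := by
  rw [continuous_iff_continuousAt]
  intro s₀
  refine continuousAt_of_locally_uniform_approx_of_continuousAt fun u hu => ?_
  obtain ⟨ε, hε, hεu⟩ := Metric.mem_uniformity_dist.1 hu
  obtain ⟨C, hC⟩ := P.S_loc_bdd _ (isCompact_Icc (a := s₀ - 1) (b := s₀ + 1))
  have hC0 : 0 ≤ C := (norm_nonneg _).trans (hC s₀ (by constructor <;> linarith))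
  obtain ⟨g, hg⟩ := P.ofCc_dense.exists_dist_lt f (ε := ε / (C + 1)) (by positivity)
  refine ⟨Set.Icc (s₀ - 1) (s₀ + 1), Icc_mem_nhds (by linarith) (by linarith),
    fun s => P.S s (P.ofCc g), (P.continuous_S_ofCc g).continuousAt, fun s hs => hεu ?_⟩
  rw [dist_eq_norm, ← map_sub]
  calc _ ≤ C * ‖f - P.ofCc g‖ := (P.S s).le_of_opNorm_le (hC s hs) _
    _ ≤ (C + 1) * ‖f - P.ofCc g‖ := by gcongr; linarith
    _ < (C + 1) * (ε / (C + 1)) := by rw [dist_eq_norm] at hg; gcongr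
    _ = ε := by field_simp

theorem T_T_neg_apply (α : ℝ) (f : H) : P.T α (P.T (-α) f) = f := by
  apply P.ext_of_ae
  filter_upwards [P.T_spec α (P.T (-α) f), P.T_spec (-α) f] with x h1 h2
  rw [h1, h2, ← mul_assoc, ← Complex.exp_add]
  simp

theorem S_T_apply (α s : ℝ) (f : H) :
    P.S s (P.T (-α) f) = Complex.exp (Complex.I * α * s) • P.T (-α) (P.S s f) := by
  apply P.ext_of_ae
  rw [map_smul]
  filter_upwards [P.S_spec s (P.T (-α) f), P.T_spec (-α) (P.S s f), P.S_spec s f,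
    AEEqFun.coeFn_smul (Complex.exp (Complex.I * α * s)) (P.ι (P.T (-α) (P.S s f))),
    (measurePreserving_sub_right volume s).quasiMeasurePreserving.ae_eq (P.T_spec (-α) f)]
    with x h1 h2 h3 h4 h5
  simp only [Function.comp_apply] at h5
  rw [h1, h5, h4, Pi.smul_apply, h2, h3, smul_eq_mul, ← mul_assoc, ← Complex.exp_add]
  congr 2
  push_cast
  ring

/-- Integration against a compactly supported continuous function, as a functional on `H`. -/
theorem exists_pairing {ψ : ℝ → ℝ} (hψ : Continuous ψ) (hc : HasCompactSupport ψ) :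
    ∃ Λ : H →L[ℂ] ℂ, ∀ f, Λ f = ∫ x, ψ x • (P.ι f : ℝ → ℂ) x := by
  have hint : ∀ f : H, Integrable fun x => ψ x • (P.ι f : ℝ → ℂ) x := fun f =>
    (P.locInt f).integrable_smul_left_of_hasCompactSupport hψ hc
  obtain ⟨c, hc0, -, hcK⟩ := P.incl_cont (tsupport ψ) hc.isCompact
  obtain ⟨B, hB⟩ := hc.exists_bound_of_continuous hψ
  have hB0 : 0 ≤ B := (norm_nonneg _).trans (hB 0)
  let L : H →ₗ[ℂ] ℂ :=
    { toFun := fun f => ∫ x, ψ x • (P.ι f : ℝ → ℂ) x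
      map_add' := fun f g => by
        rw [← integral_add (hint f) (hint g), map_add]
        refine integral_congr_ae ?_
        filter_upwards [AEEqFun.coeFn_add (P.ι f) (P.ι g)] with x h
        rw [h, Pi.add_apply, smul_add]
      map_smul' := fun a f => by
        rw [map_smul, RingHom.id_apply, ← integral_smul]
        refine integral_congr_ae ?_
        filter_upwards [AEEqFun.coeFn_smul a (P.ι f)] with x h
        rw [h, Pi.smul_apply, smul_comm] }
  refine ⟨L.mkContinuous (B * c) fun f => ?_, fun f => rfl⟩
  have h1 : L f = ∫ x in tsupport ψ, ψ x • (P.ι f : ℝ → ℂ) x := by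
    refine (setIntegral_eq_integral_of_forall_compl_eq_zero fun s hs => ?_).symm
    rw [image_eq_zero_of_notMem_tsupport hs, zero_smul]
  rw [h1]
  have hfi : IntegrableOn (P.ι f : ℝ → ℂ) (tsupport ψ) :=
    (P.locInt f).integrableOn_isCompact hc.isCompact
  calc _ ≤ ∫ x in tsupport ψ, ‖ψ x • (P.ι f : ℝ → ℂ) x‖ := norm_integral_le_integral_norm _
    _ ≤ ∫ x in tsupport ψ, B * ‖(P.ι f : ℝ → ℂ) x‖ := by
      refine integral_mono (hint f).integrableOn.norm (hfi.norm.const_mul _) fun x => ?_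
      simp only [norm_smul]
      gcongr
      exact hB x
    _ = B * ∫ x in tsupport ψ, ‖(P.ι f : ℝ → ℂ) x‖ := integral_const_mul _ _
    _ ≤ B * c * ‖f‖ := by
      rw [mul_assoc]
      gcongr
      exact hcK f

theorem integrable_smul_S {ψ : ℝ → ℂ} (hψ : Continuous ψ) (hc : HasCompactSupport ψ) (f : H) :
    Integrable fun s => ψ s • P.S s f :=
  (hψ.smul (P.continuous_S_apply f)).integrable_of_hasCompactSupport hc.smul_right

theorem ext_of_pairing {f g : H} (h : ∀ Λ : H →L[ℂ] ℂ, ∀ ψ : ℝ → ℝ, Continuous ψ →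
    HasCompactSupport ψ → (∀ f, Λ f = ∫ x, ψ x • (P.ι f : ℝ → ℂ) x) → Λ f = Λ g) : f = g := by
  apply P.ext_of_ae
  refine ae_eq_of_integral_contDiff_smul_eq (P.locInt f) (P.locInt g) fun ψ hψ hc => ?_
  obtain ⟨Λ, hΛ⟩ := P.exists_pairing hψ.continuous hc
  rw [← hΛ, ← hΛ]
  exact h Λ ψ hψ.continuous hc hΛ

/-- A convolution operator is the integral of translations against its kernel. -/
theorem apply_eq_integral_S (φ : CompactlySupportedContinuousMap ℝ ℂ) (N : H →L[ℂ] H)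
    (hN : ∀ f : H, (P.ι (N f) : ℝ → ℂ) =ᵐ[volume]
      fun x => ∫ y : ℝ, (P.ι f : ℝ → ℂ) (x - y) * φ y) (h : H) :
    N h = ∫ s, φ s • P.S s h := by
  obtain ⟨B, hB⟩ := P.S_loc_bdd _ φ.hasCompactSupport.isCompact
  have hint : ∀ f : H, Integrable fun s => φ s • P.S s f :=
    P.integrable_smul_S φ.continuous φ.hasCompactSupport
  let L : H →ₗ[ℂ] H :=
    { toFun := fun h => ∫ s, φ s • P.S s h
      map_add' := fun f g => by
        simp only [map_add, smul_add]
        exact integral_add (hint f) (hint g)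
      map_smul' := fun a f => by
        simp only [map_smul, RingHom.id_apply, ← integral_smul]
        congr 1
        ext s
        rw [smul_comm] }
  let M : H →L[ℂ] H := L.mkContinuous ((∫ s, ‖φ s‖) * B) fun f => by
    have hφ : Integrable φ := φ.continuous.integrable_of_hasCompactSupport φ.hasCompactSupport
    calc _ ≤ ∫ s, ‖φ s • P.S s f‖ := norm_integral_le_integral_norm _
      _ ≤ ∫ s, ‖φ s‖ * (B * ‖f‖) := by
        refine integral_mono (hint f).norm (hφ.norm.mul_const _) fun s => ?_
        simp only [norm_smul]
        by_cases hs : s ∈ tsupport φ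
        · gcongr
          exact (P.S s).le_of_opNorm_le (hB s hs) f
        · simp [image_eq_zero_of_notMem_tsupport hs]
      _ = _ := by rw [integral_mul_const, mul_assoc]
  suffices hNM : (N : H → H) = M from congrFun hNM h
  refine P.ofCc_dense.equalizer N.continuous M.continuous (funext fun g => ?_)
  refine P.ext_of_pairing fun Λ ψ hψ hψc hΛ => ?_
  have hM : M (P.ofCc g) = ∫ s, φ s • P.S s (P.ofCc g) := rfl
  have h1 : ∀ s, Λ (φ s • P.S s (P.ofCc g)) = ∫ x, (ψ x : ℂ) * (φ s * g (x - s)) := by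
    intro s
    rw [map_smul, P.S_ofCc, hΛ, ← integral_smul]
    refine integral_congr_ae ?_
    filter_upwards [P.ofCc_spec (g.translate s)] with x hx
    rw [hx]
    simp
    ring
  have h2 : Λ (N (P.ofCc g)) = ∫ x, ∫ s, (ψ x : ℂ) * (φ s * g (x - s)) := by
    rw [hΛ]
    refine integral_congr_ae ?_
    filter_upwards [hN (P.ofCc g)] with x hx
    rw [hx, integral_const_mul, Complex.real_smul]
    congr 1
    refine integral_congr_ae ?_
    filter_upwards [(Measure.measurePreserving_sub_left volume x).quasiMeasurePreserving.ae_eq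
      (P.ofCc_spec g)] with s hs
    simp only [Function.comp_apply] at hs
    rw [hs, mul_comm]
  simp only [Function.comp_apply]
  rw [hM, ← Λ.integral_comp_comm (hint _), h2]
  simp_rw [h1]
  apply integral_integral_swap_of_hasCompactSupport
  · simp only [Function.uncurry_def]
    fun_prop
  · refine HasCompactSupport.intro (hψc.isCompact.prod φ.hasCompactSupport.isCompact) ?_
    rintro ⟨x, s⟩ hn
    rw [Set.mem_prod, not_and_or] at hn
    rcases hn with hn | hn
    · simp only at hn
      simp [image_eq_zero_of_notMem_tsupport hn]
    · simp only at hn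
      simp [image_eq_zero_of_notMem_tsupport hn]

/-- If `‖N‖ < ‖c‖`, the operators obtained by modulating `N - c` are uniformly bounded below. -/
theorem exists_uniform_lower_bound (φ : CompactlySupportedContinuousMap ℝ ℂ) (N : H →L[ℂ] H)
    (hN : ∀ f : H, N f = ∫ s, φ s • P.S s f) {c : ℂ} (hc : ‖N‖ < ‖c‖) :
    ∃ δ > 0, ∀ (α : ℝ) (h : H), δ * ‖h‖ ≤
      ‖(∫ s, (φ s * Complex.exp (Complex.I * α * s)) • P.S s h) - c • h‖ := by
  obtain ⟨C₀, hC₀⟩ := P.T_bdd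
  set C := max C₀ 1
  have hC : ∀ α, ‖P.T α‖ ≤ C := fun α => (hC₀ α).trans (le_max_left _ _)
  have hC0 : 0 < C := lt_of_lt_of_le one_pos (le_max_right _ _)
  have hd : 0 < ‖c‖ - ‖N‖ := sub_pos.2 hc
  refine ⟨(‖c‖ - ‖N‖) / C ^ 2, by positivity, fun α h => ?_⟩
  set u := (∫ s, (φ s * Complex.exp (Complex.I * α * s)) • P.S s h) - c • h with hu
  have hint : Integrable fun s : ℝ => (φ s * Complex.exp (Complex.I * α * s)) • P.S s h :=
    P.integrable_smul_S (ψ := fun s : ℝ => φ s * Complex.exp (Complex.I * α * s))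
      (by fun_prop) φ.hasCompactSupport.mul_right h
  have h1 : N (P.T (-α) h) - c • P.T (-α) h = P.T (-α) u := by
    rw [hu, map_sub, map_smul, ← (P.T (-α)).integral_comp_comm hint, hN]
    congr 2
    ext s
    rw [P.S_T_apply, map_smul, smul_smul]
  have h2 : ‖h‖ ≤ C * ‖P.T (-α) h‖ := by
    conv_lhs => rw [← P.T_T_neg_apply α h]
    exact (P.T α).le_of_opNorm_le (hC α) _
  have h3 : (‖c‖ - ‖N‖) * ‖P.T (-α) h‖ ≤ ‖N (P.T (-α) h) - c • P.T (-α) h‖ := by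
    rw [norm_sub_rev]
    refine le_trans ?_ (norm_sub_norm_le _ _)
    rw [norm_smul, sub_mul]
    gcongr
    exact N.le_opNorm _
  have h4 : ‖P.T (-α) u‖ ≤ C * ‖u‖ := (P.T (-α)).le_of_opNorm_le (hC _) _
  rw [h1] at h3
  rw [div_mul_eq_mul_div, div_le_iff₀ (by positivity)]
  calc (‖c‖ - ‖N‖) * ‖h‖ ≤ (‖c‖ - ‖N‖) * (C * ‖P.T (-α) h‖) := by gcongr
    _ = C * ((‖c‖ - ‖N‖) * ‖P.T (-α) h‖) := by ring
    _ ≤ C * (C * ‖u‖) := by exact mul_le_mul_of_nonneg_left (h3.trans h4) hC0.le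
    _ = ‖u‖ * C ^ 2 := by ring

/-- Smoothing a windowed orbit by a kernel amounts to convolving the window. -/
theorem integral_smul_S_integral {φ χ : ℝ → ℂ} (hφ : Continuous φ) (hφc : HasCompactSupport φ)
    (hχ : Continuous χ) (hχc : HasCompactSupport χ) (ζ : ℂ) (f : H) :
    (∫ s, φ s • P.S s (∫ t : ℝ, (χ t * Complex.exp (-ζ * t)) • P.S t f)) =
      ∫ t : ℝ, ((∫ s : ℝ, φ s * Complex.exp (ζ * s) * χ (t - s)) * Complex.exp (-ζ * t)) •
        P.S t f := by
  have hint : Integrable fun t : ℝ => (χ t * Complex.exp (-ζ * t)) • P.S t f :=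
    P.integrable_smul_S (ψ := fun t : ℝ => χ t * Complex.exp (-ζ * t))
      (by fun_prop) hχc.mul_right f
  have h1 : ∀ s : ℝ, φ s • P.S s (∫ t : ℝ, (χ t * Complex.exp (-ζ * t)) • P.S t f) =
      ∫ t : ℝ, (φ s * Complex.exp (ζ * s) * χ (t - s) * Complex.exp (-ζ * t)) • P.S t f := by
    intro s
    rw [← (P.S s).integral_comp_comm hint, ← integral_smul]
    refine Eq.trans ?_ (integral_add_left_eq_self _ s)
    congr 1
    ext t
    rw [map_smul, P.S_S_apply, smul_smul]
    congr 1
    have : Complex.exp (-ζ * t) = Complex.exp (ζ * s) * Complex.exp (-ζ * ((s + t : ℝ) : ℂ)) := by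
      rw [← Complex.exp_add]
      congr 1
      push_cast
      ring
    rw [this, add_sub_cancel_left]
    ring
  simp_rw [h1]
  have hS := P.continuous_S_apply f
  rw [integral_integral_swap_of_hasCompactSupport]
  · congr 1
    ext t
    rw [integral_smul_const, integral_mul_const]
  · simp only [Function.uncurry_def]
    fun_prop
  · refine HasCompactSupport.intro (K := (fun p : ℝ × ℝ => (p.1, p.1 + p.2)) ''
      (tsupport φ ×ˢ tsupport χ)) ((hφc.isCompact.prod hχc.isCompact).image (by fun_prop)) ?_
    rintro ⟨s, t⟩ hn
    simp only [Function.uncurry_apply_pair]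
    by_contra hne
    apply hn
    refine ⟨(s, t - s), ⟨?_, ?_⟩, by simp⟩
    · apply subset_tsupport
      intro h0
      simp [h0] at hne
    · apply subset_tsupport
      intro h0
      simp only at h0
      simp [h0] at hne

/-- An approximate eigenvalue `z` of `S 1` yields orbits that, once rescaled by `|z|⁻ᵗ`,
stay comparable to a constant on arbitrarily long intervals. -/
theorem exists_orbit_bounds {z : ℂ} (hz0 : z ≠ 0)
    (hz : ∀ ε > 0, ∃ f : H, ‖P.S 1 f - z • f‖ < ε * ‖f‖) :
    ∃ a > 0, ∃ b > 0, ∀ R : ℝ, ∃ f : H, ∀ t ∈ Set.Icc 0 R,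
      a ≤ ‖Complex.exp (-(Real.log ‖z‖ * t : ℝ)) • P.S t f‖ ∧
      ‖Complex.exp (-(Real.log ‖z‖ * t : ℝ)) • P.S t f‖ ≤ b := by
  set w := Real.log ‖z‖ with hw
  have hr : 0 < ‖z‖ := norm_pos_iff.2 hz0
  have hunit : ∀ k : ℕ, ∃ f : H, ‖f‖ = 1 ∧ ‖P.S 1 f - z • f‖ < 1 / ((k : ℝ) + 1) := by
    intro k
    obtain ⟨f, hf⟩ := hz (1 / ((k : ℝ) + 1)) (by positivity)
    have hf0 : 0 < ‖f‖ := by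
      by_contra! h0
      have h1 : ‖f‖ = 0 := le_antisymm h0 (norm_nonneg f)
      rw [h1, mul_zero] at hf
      exact absurd hf (not_lt.2 (norm_nonneg _))
    refine ⟨((‖f‖⁻¹ : ℝ) : ℂ) • f, ?_, ?_⟩
    · rw [norm_smul, Complex.norm_real, norm_inv, norm_norm, inv_mul_cancel₀ hf0.ne']
    · rw [map_smul, smul_comm, ← smul_sub, norm_smul, Complex.norm_real, norm_inv, norm_norm,
        inv_mul_lt_iff₀ hf0, mul_comm]
      exact hf
  choose f hf1 hf using hunit
  have hlim1 : Tendsto (fun k => P.S 1 (f k) - z • f k) atTop (𝓝 0) :=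
    squeeze_zero_norm (fun k => (hf k).le) tendsto_one_div_add_atTop_nhds_zero_nat
  have hlim : ∀ j : ℕ, Tendsto (fun k => P.S j (f k) - z ^ j • f k) atTop (𝓝 0) := by
    intro j
    induction j with
    | zero => simp [P.S_zero]
    | succ j ih =>
      have h := (((P.S 1).continuous.tendsto 0).comp ih).add (hlim1.const_smul (z ^ j))
      rw [map_zero, smul_zero, add_zero] at h
      refine h.congr fun k => ?_
      simp only [Function.comp_apply]
      rw [map_sub, P.S_S_apply, map_smul, smul_sub, smul_smul, ← pow_succ, add_comm (1 : ℝ)]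
      push_cast
      abel
  obtain ⟨M₀, hM₀⟩ := P.S_loc_bdd _ (isCompact_Icc (a := (-1 : ℝ)) (b := 1))
  set M := max M₀ 1
  have hM : ∀ x ∈ Set.Icc (-1 : ℝ) 1, ‖P.S x‖ ≤ M := fun x hx => (hM₀ x hx).trans (le_max_left _ _)
  have hM0 : 0 < M := lt_of_lt_of_le one_pos (le_max_right _ _)
  refine ⟨Real.exp (-|w|) * (1 / (2 * M)), by positivity, Real.exp |w| * (M * (3 / 2)),
    by positivity, fun R => ?_⟩
  have hev : ∀ᶠ k in atTop, ∀ j ∈ Finset.range (⌊R⌋₊ + 1),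
      ‖P.S j (f k) - z ^ j • f k‖ < ‖z‖ ^ j / 2 := by
    rw [Finset.eventually_all]
    intro j _
    have := (hlim j).norm
    rw [norm_zero] at this
    exact this.eventually_lt_const (by positivity)
  obtain ⟨k, hk⟩ := hev.exists
  refine ⟨f k, fun t ht => ?_⟩
  set j := ⌊t⌋₊
  have hj := hk j (Finset.mem_range.2 (Nat.lt_succ_of_le (Nat.floor_le_floor ht.2)))
  have hjt : (j : ℝ) ≤ t := Nat.floor_le ht.1
  have htj : t < j + 1 := Nat.lt_floor_add_one t
  have hzj : ‖z ^ j • f k‖ = ‖z‖ ^ j := by rw [norm_smul, hf1, mul_one, norm_pow]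
  have hup : ‖P.S j (f k)‖ ≤ ‖z‖ ^ j * (3 / 2) := by
    have := norm_le_norm_add_norm_sub' (P.S j (f k)) (z ^ j • f k)
    rw [hzj] at this
    linarith
  have hlo : ‖z‖ ^ j / 2 ≤ ‖P.S j (f k)‖ := by
    have := norm_le_norm_add_norm_sub (P.S j (f k)) (z ^ j • f k)
    rw [hzj] at this
    linarith
  have h1 : ‖P.S t (f k)‖ ≤ M * ‖P.S j (f k)‖ := by
    have : P.S t (f k) = P.S (t - j) (P.S j (f k)) := by rw [P.S_S_apply, sub_add_cancel]
    rw [this]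
    exact (P.S _).le_of_opNorm_le (hM _ (by constructor <;> linarith)) _
  have h2 : ‖P.S j (f k)‖ ≤ M * ‖P.S t (f k)‖ := by
    have : P.S j (f k) = P.S (j - t) (P.S t (f k)) := by rw [P.S_S_apply, sub_add_cancel]
    rw [this]
    exact (P.S _).le_of_opNorm_le (hM _ (by constructor <;> linarith)) _
  have hexp : Real.exp (-(w * t)) = Real.exp (-(w * (t - j))) * (‖z‖ ^ j)⁻¹ := by
    have : ‖z‖ ^ j = Real.exp (w * j) := by
      rw [mul_comm, Real.exp_nat_mul, hw, Real.exp_log hr]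
    rw [this, ← Real.exp_neg, ← Real.exp_add]
    congr 1
    ring
  have habs : |w * (t - j)| ≤ |w| := by
    rw [abs_mul]
    exact mul_le_of_le_one_right (abs_nonneg _) (by rw [abs_le]; constructor <;> linarith)
  rw [abs_le] at habs
  have hnorm : ‖Complex.exp (-(w * t : ℝ)) • P.S t (f k)‖ =
      Real.exp (-(w * (t - j))) * ((‖z‖ ^ j)⁻¹ * ‖P.S t (f k)‖) := by
    rw [norm_smul, Complex.norm_exp, ← mul_assoc, ← hexp]
    simp
  rw [hnorm]
  have hzp : 0 < ‖z‖ ^ j := by positivity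
  constructor
  · gcongr
    · linarith
    · rw [← div_eq_inv_mul, div_le_div_iff₀ (by positivity) hzp]
      linarith
  · refine mul_le_mul (Real.exp_le_exp.2 (by linarith)) ?_ (by positivity) (by positivity)
    · rw [← div_eq_inv_mul, div_le_iff₀ hzp]
      calc _ ≤ M * ‖P.S j (f k)‖ := h1
        _ ≤ M * (‖z‖ ^ j * (3 / 2)) := by gcongr
        _ = _ := by ring

open FourierTransform in
/-- Comparison of the `L²` norms of an orbit windowed by `χ`, and by the defect of `χ` under
convolution with `φ`. -/
theorem integral_norm_sq_window_le (φ : CompactlySupportedContinuousMap ℝ ℂ) {c ζ₀ : ℂ} {w δ : ℝ}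
    (hδ : 0 ≤ δ) (hζ : ζ₀.re = w)
    (hlow : ∀ (α : ℝ) (h : H), δ * ‖h‖ ≤
      ‖(∫ s, (φ s * Complex.exp (Complex.I * α * s)) • P.S s h) - c • h‖)
    {χ : ℝ → ℂ} (hχ : Continuous χ) (hχc : HasCompactSupport χ) {Θ : ℝ → ℂ}
    (hΘ : Continuous Θ) (hΘc : HasCompactSupport Θ)
    (hΘχ : ∀ t, Θ t = (∫ s : ℝ, φ s * Complex.exp (ζ₀ * s) * χ (t - s)) - c * χ t) (f : H) :
    δ ^ 2 * ∫ t : ℝ, ‖χ t • Complex.exp (-(w * t : ℝ)) • P.S t f‖ ^ 2 ≤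
      ∫ t : ℝ, ‖Θ t • Complex.exp (-(w * t : ℝ)) • P.S t f‖ ^ 2 := by
  have hS := P.continuous_S_apply f
  refine integral_norm_sq_le_of_norm_fourier_le (by fun_prop) hχc.smul_right (by fun_prop)
    hΘc.smul_right hδ fun v => ?_
  set ζ : ℂ := w + 2 * π * v * I with hζdef
  have hFour : ∀ η : ℝ → ℂ, 𝓕 (fun t : ℝ => η t • Complex.exp (-(w * t : ℝ)) • P.S t f) v =
      ∫ t : ℝ, (η t * Complex.exp (-ζ * t)) • P.S t f := by
    intro η
    rw [Real.fourier_real_eq_integral_exp_smul]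
    congr 1
    ext t
    rw [smul_smul, smul_smul, mul_comm (Complex.exp _) (η t), mul_assoc, ← Complex.exp_add]
    congr 3
    rw [hζdef]
    push_cast
    ring
  change δ * ‖𝓕 (fun t : ℝ => χ t • Complex.exp (-(w * t : ℝ)) • P.S t f) v‖ ≤
    ‖𝓕 (fun t : ℝ => Θ t • Complex.exp (-(w * t : ℝ)) • P.S t f) v‖
  rw [hFour, hFour]
  set h := ∫ t : ℝ, (χ t * Complex.exp (-ζ * t)) • P.S t f with hh
  refine (hlow (ζ₀.im - 2 * π * v) h).trans (le_of_eq ?_)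
  congr 1
  set α : ℝ := ζ₀.im - 2 * π * v with hα
  have hαζ : Complex.I * α + ζ = ζ₀ := by
    rw [hα, hζdef]
    conv_rhs => rw [← Complex.re_add_im ζ₀, hζ]
    push_cast
    ring
  rw [hh, P.integral_smul_S_integral (φ := fun s : ℝ => φ s * Complex.exp (Complex.I * α * s))
    (by fun_prop) φ.hasCompactSupport.mul_right hχ hχc ζ f]
  have e1 : ∀ t : ℝ, (∫ s : ℝ, φ s * Complex.exp (Complex.I * α * s) * Complex.exp (ζ * s) *
      χ (t - s)) = Θ t + c * χ t := by
    intro t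
    rw [hΘχ, sub_add_cancel]
    congr 1
    ext s
    rw [mul_assoc (φ s), ← Complex.exp_add, ← add_mul, hαζ]
  simp_rw [e1]
  rw [← integral_smul, ← integral_sub]
  · congr 1
    ext t
    rw [smul_smul, ← sub_smul]
    congr 1
    ring
  · exact P.integrable_smul_S (ψ := fun t : ℝ => (Θ t + c * χ t) * Complex.exp (-ζ * t))
      (by fun_prop) (hΘc.add hχc.mul_left).mul_right f
  · exact (P.integrable_smul_S (ψ := fun t : ℝ => χ t * Complex.exp (-ζ * t))
      (by fun_prop) hχc.mul_right f).smul c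

/-- If `z` is an approximate eigenvalue of `S 1`, the Laplace-Fourier transform of `φ` on the line
`Re ζ₀ = log |z|` is bounded by the norm of the convolution operator. -/
theorem norm_integral_mul_exp_le (φ : CompactlySupportedContinuousMap ℝ ℂ) (N : H →L[ℂ] H)
    (hN : ∀ f : H, N f = ∫ s, φ s • P.S s f) {z : ℂ} (hz0 : z ≠ 0)
    (hz : ∀ ε > 0, ∃ f : H, ‖P.S 1 f - z • f‖ < ε * ‖f‖) {ζ₀ : ℂ} (hζ : ζ₀.re = Real.log ‖z‖) :
    ‖∫ s : ℝ, φ s * Complex.exp (ζ₀ * s)‖ ≤ ‖N‖ := by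
  by_contra! hlt
  set w := Real.log ‖z‖
  set c := ∫ s : ℝ, φ s * Complex.exp (ζ₀ * s) with hc
  obtain ⟨δ, hδ, hlow⟩ := P.exists_uniform_lower_bound φ N hN hlt
  obtain ⟨a, ha, b, hb, horb⟩ := P.exists_orbit_bounds hz0 hz
  obtain ⟨r₀, hr₀⟩ := φ.hasCompactSupport.isCompact.isBounded.exists_norm_le
  set r := max r₀ 0
  have hr0 : 0 ≤ r := le_max_right _ _
  have hr : ∀ s ∈ tsupport φ, |s| ≤ r := fun s hs => (hr₀ s hs).trans (le_max_left _ _)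
  set k : ℝ → ℂ := fun s => φ s * Complex.exp (ζ₀ * s) with hk
  have hkc : Continuous k := by fun_prop
  have hks : HasCompactSupport k := φ.hasCompactSupport.mul_right
  have hk0 : ∀ s, r < |s| → k s = 0 := by
    intro s hs
    have : φ s = 0 := image_eq_zero_of_notMem_tsupport fun h => absurd (hr s h) (not_le.2 hs)
    simp [hk, this]
  set B := ∫ s, ‖k s‖ * |s|
  have hB : 0 ≤ B := integral_nonneg fun s => by positivity
  have main : ∀ R : ℝ, 0 < R → δ ^ 2 * ((R / 2 * a) ^ 2 * R) ≤ (B * b) ^ 2 * (2 * R + 2 * r) := by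
    intro R hR
    obtain ⟨f, hf⟩ := horb (2 * R + 2 * r)
    set χ : ℝ → ℝ := fun t => max 0 (R - |t - (R + r)|) with hχ
    have hχcont : Continuous χ := by fun_prop
    have hχ0 : ∀ t, R ≤ |t - (R + r)| → χ t = 0 := fun t ht => max_eq_left (by linarith)
    have hχlip : ∀ s t, |χ (t - s) - χ t| ≤ |s| := by
      intro s t
      refine (abs_max_sub_max_le_max _ _ _ _).trans ?_
      rw [sub_self, abs_zero, max_eq_right (abs_nonneg _)]
      have := abs_abs_sub_abs_le_abs_sub (t - (R + r)) (t - s - (R + r))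
      rw [show R - |t - s - (R + r)| - (R - |t - (R + r)|) =
        |t - (R + r)| - |t - s - (R + r)| by ring]
      refine this.trans (le_of_eq ?_)
      congr 1
      ring
    have hχs : HasCompactSupport fun t => (χ t : ℂ) := by
      refine HasCompactSupport.intro (K := Set.Icc 0 (2 * R + 2 * r)) isCompact_Icc fun t ht => ?_
      rw [hχ0 t, Complex.ofReal_zero]
      by_contra! h
      rw [abs_lt] at h
      exact ht (by constructor <;> linarith)
    set Θ : ℝ → ℂ := fun t => (∫ s : ℝ, k s * (χ (t - s) : ℂ)) - c * χ t with hΘ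
    have hint : ∀ t, Integrable fun s : ℝ => k s * (χ (t - s) : ℂ) := fun t =>
      (by fun_prop : Continuous fun s : ℝ => k s * (χ (t - s) : ℂ)).integrable_of_hasCompactSupport
        hks.mul_right
    have hki : Integrable k := hkc.integrable_of_hasCompactSupport hks
    have hΘ' : ∀ t, Θ t = ∫ s : ℝ, k s * ((χ (t - s) - χ t : ℝ) : ℂ) := by
      intro t
      simp only [hΘ]
      rw [hc, ← integral_mul_const, ← integral_sub (hint t) (hki.mul_const _)]
      congr 1
      ext s
      push_cast
      ring
    have hΘcont : Continuous Θ := by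
      have : ∀ t, (∫ s : ℝ, k s * (χ (t - s) : ℂ)) = ∫ s in tsupport k, k s * (χ (t - s) : ℂ) := by
        intro t
        refine (setIntegral_eq_integral_of_forall_compl_eq_zero fun s hs => ?_).symm
        rw [image_eq_zero_of_notMem_tsupport hs, zero_mul]
      simp only [hΘ, this]
      refine Continuous.sub ?_ (by fun_prop)
      exact continuous_parametric_integral_of_continuous (by fun_prop) hks.isCompact
    have hΘbd : ∀ t, ‖Θ t‖ ≤ B := by
      intro t
      rw [hΘ' t]
      refine norm_integral_le_of_norm_le ?_ (Eventually.of_forall fun s => ?_)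
      · exact (by fun_prop : Continuous fun s : ℝ => ‖k s‖ * |s|).integrable_of_hasCompactSupport
          hks.norm.mul_right
      · rw [norm_mul, Complex.norm_real, Real.norm_eq_abs]
        exact mul_le_mul_of_nonneg_left (hχlip s t) (norm_nonneg _)
    have hΘ0 : ∀ t, t ∉ Set.Icc 0 (2 * R + 2 * r) → Θ t = 0 := by
      intro t ht
      rw [hΘ' t]
      refine integral_eq_zero_of_ae (Eventually.of_forall fun s => ?_)
      rcases lt_or_ge r |s| with h | h
      · simp [hk0 s h]
      · have h1 : R + r ≤ |t - (R + r)| := by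
          by_contra! h1
          rw [abs_lt] at h1
          exact ht (by constructor <;> linarith)
        have h2 : R ≤ |t - s - (R + r)| := by
          have := abs_sub_abs_le_abs_sub (t - (R + r)) s
          rw [show t - s - (R + r) = t - (R + r) - s by ring]
          linarith
        simp [hχ0 t (by linarith), hχ0 (t - s) h2]
    have hΘs : HasCompactSupport Θ := HasCompactSupport.intro isCompact_Icc hΘ0
    have hS := P.continuous_S_apply f
    have hcmp := P.integral_norm_sq_window_le φ hδ.le hζ hlow (χ := fun t => (χ t : ℂ))
      (by fun_prop) hχs hΘcont hΘs (fun t => rfl) f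
    have hvol : ∀ x y : ℝ, x ≤ y → volume.real (Set.Icc x y) = y - x := fun x y hxy => by
      rw [Measure.real, Real.volume_Icc, ENNReal.toReal_ofReal (by linarith)]
    have hlower : (R / 2 * a) ^ 2 * R ≤
        ∫ t : ℝ, ‖(χ t : ℂ) • Complex.exp (-(w * t : ℝ)) • P.S t f‖ ^ 2 := by
      have hFi : Integrable fun t : ℝ => ‖(χ t : ℂ) • Complex.exp (-(w * t : ℝ)) • P.S t f‖ ^ 2 := by
        refine Continuous.integrable_of_hasCompactSupport (by fun_prop) ?_
        refine (hχs.smul_right (f' := fun t : ℝ => Complex.exp (-(w * t : ℝ)) • P.S t f)).comp_left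
          (g := fun y : H => ‖y‖ ^ 2) (by simp)
      refine le_trans ?_ (setIntegral_le_integral (s := Set.Icc (R / 2 + r) (3 * R / 2 + r)) hFi
        (Eventually.of_forall fun t => by positivity))
      have hconst : (∫ _ in Set.Icc (R / 2 + r) (3 * R / 2 + r), (R / 2 * a) ^ 2) =
          (R / 2 * a) ^ 2 * R := by
        rw [setIntegral_const, hvol _ _ (by linarith), smul_eq_mul]
        ring
      rw [← hconst]
      refine setIntegral_mono_on continuous_const.integrableOn_Icc hFi.integrableOn
        measurableSet_Icc fun t ht => ?_
      rw [norm_smul, Complex.norm_real, Real.norm_eq_abs]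
      have h1 : R / 2 ≤ |χ t| := by
        refine le_trans (le_trans ?_ (le_max_right 0 _)) (le_abs_self _)
        have : |t - (R + r)| ≤ R / 2 := by
          rw [abs_le]
          constructor <;> linarith [ht.1, ht.2]
        linarith
      gcongr
      exact (hf t (by constructor <;> linarith [ht.1, ht.2])).1
    have hupper : (∫ t : ℝ, ‖Θ t • Complex.exp (-(w * t : ℝ)) • P.S t f‖ ^ 2) ≤
        (B * b) ^ 2 * (2 * R + 2 * r) := by
      have hQi : Integrable fun t : ℝ => ‖Θ t • Complex.exp (-(w * t : ℝ)) • P.S t f‖ ^ 2 := by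
        refine Continuous.integrable_of_hasCompactSupport (by fun_prop) ?_
        refine (hΘs.smul_right (f' := fun t : ℝ => Complex.exp (-(w * t : ℝ)) • P.S t f)).comp_left
          (g := fun y : H => ‖y‖ ^ 2) (by simp)
      rw [← setIntegral_eq_integral_of_forall_compl_eq_zero (s := Set.Icc 0 (2 * R + 2 * r))
        fun t ht => by simp [hΘ0 t ht]]
      have hconst : (∫ _ in Set.Icc 0 (2 * R + 2 * r), (B * b) ^ 2) =
          (B * b) ^ 2 * (2 * R + 2 * r) := by
        rw [setIntegral_const, hvol _ _ (by linarith), smul_eq_mul]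
        ring
      rw [← hconst]
      refine setIntegral_mono_on hQi.integrableOn continuous_const.integrableOn_Icc
        measurableSet_Icc fun t ht => ?_
      rw [norm_smul]
      gcongr
      · exact hΘbd t
      · exact (hf t ht).2
    exact (mul_le_mul_of_nonneg_left hlower (by positivity)).trans (hcmp.trans hupper)
  set R := r + 1 + 4 * (B * b) / (δ * a) with hR
  have hR0 : 0 < R := by positivity
  have hRr : r ≤ R := by
    have : 0 ≤ 4 * (B * b) / (δ * a) := by positivity
    linarith
  have hRB : 4 * (B * b) < δ * a * R := by
    have : δ * a * R = δ * a * (r + 1) + 4 * (B * b) := by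
      rw [hR, mul_add, mul_div_cancel₀ _ (by positivity)]
    have : 0 < δ * a * (r + 1) := by positivity
    linarith
  have hsq : (4 * (B * b)) ^ 2 < (δ * a * R) ^ 2 := by gcongr
  have h1 := main R hR0
  have h2 : (B * b) ^ 2 * (2 * R + 2 * r) ≤ (B * b) ^ 2 * (4 * R) := by gcongr; linarith
  nlinarith

theorem spectrum_ne_zero (s : ℝ) {z : ℂ} (hz : z ∈ spectrum ℂ (P.S s)) : z ≠ 0 := by
  rintro rfl
  have h : ∀ t : ℝ, P.S t * P.S (-t) = 1 := fun t => by
    have := P.S_add t (-t)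
    rwa [add_neg_cancel, P.S_zero] at this
  have hu : IsUnit (P.S s) := ⟨⟨P.S s, P.S (-s), h s, by simpa using h (-s)⟩, rfl⟩
  exact (spectrum.zero_notMem_iff ℂ).2 hu hz

theorem ofCc_ne_zero {φ : CompactlySupportedContinuousMap ℝ ℂ} (hφ : (φ : ℝ → ℂ) ≠ 0) :
    P.ofCc φ ≠ 0 := by
  intro h
  have h1 := P.ofCc_spec φ
  rw [h, map_zero] at h1
  have h2 : (φ : ℝ → ℂ) =ᵐ[volume] (0 : ℝ → ℂ) := h1.symm.trans AEEqFun.coeFn_zero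
  exact hφ (φ.continuous.ae_eq_iff_eq volume continuous_zero |>.1 h2)

end MultiplierSetup

/-- The bound `|φ̂(z)| ≤ ‖M_φ‖` on the two boundary lines `Im z = log ρ(S)` and
`Im z = -log ρ(S⁻¹)` of the strip `Ω`, where `φ̂(z) = ∫ φ(t) e^(-i z t) dt` and `M_φ`
is the convolution operator by `φ ∈ C_c(ℝ)` on `H`. -/
theorem fourier_bound_on_boundary_lines {H : Type} [NormedAddCommGroup H]
    [InnerProductSpace ℂ H] [CompleteSpace H] (P : MultiplierSetup H)
    (φ : CompactlySupportedContinuousMap ℝ ℂ) (N : H →L[ℂ] H)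
    (hN : ∀ f : H, (P.ι (N f) : ℝ → ℂ) =ᵐ[volume]
      fun x => ∫ y : ℝ, (P.ι f : ℝ → ℂ) (x - y) * φ y)
    (x : ℝ) :
    ‖∫ t : ℝ, φ t * Complex.exp (-(Complex.I *
        (x + Complex.I * Real.log ((spectralRadius ℂ (P.S 1)).toReal)) * t))‖ ≤ ‖N‖ ∧
    ‖∫ t : ℝ, φ t * Complex.exp (-(Complex.I *
        (x - Complex.I * Real.log ((spectralRadius ℂ (P.S (-1))).toReal)) * t))‖ ≤ ‖N‖ := by
  have hN' := P.apply_eq_integral_S φ N hN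
  rcases eq_or_ne (φ : ℝ → ℂ) 0 with h0 | h0
  · simp [h0]
  have : Nontrivial H := ⟨_, _, P.ofCc_ne_zero h0⟩
  constructor
  · obtain ⟨z, hz, hzr⟩ := spectrum.exists_nnnorm_eq_spectralRadius (P.S 1)
    have hz0 := P.spectrum_ne_zero 1 hz
    have hre : (Real.log ‖z‖ - Complex.I * x : ℂ).re = Real.log ‖z‖ := by simp
    refine le_trans (le_of_eq ?_) (P.norm_integral_mul_exp_le φ N hN' hz0
      (fun ε hε => exists_norm_sub_smul_lt_of_norm_eq_spectralRadius hz0 hz hzr hε) hre)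
    rw [← hzr, ENNReal.coe_toReal, coe_nnnorm]
    congr 3
    ext t
    congr 2
    linear_combination (-(Real.log ‖z‖ : ℂ) * t) * Complex.I_sq
  · obtain ⟨z, hz, hzr⟩ := spectrum.exists_nnnorm_eq_spectralRadius (P.S (-1))
    have hz0 := P.spectrum_ne_zero (-1) hz
    have hre : (-Real.log ‖z‖ - Complex.I * x : ℂ).re = Real.log ‖z⁻¹‖ := by
      simp [norm_inv, Real.log_inv]
    have happ : ∀ ε > 0, ∃ f : H, ‖P.S 1 f - z⁻¹ • f‖ < ε * ‖f‖ := by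
      intro ε hε
      have hzn : 0 < ‖z‖ := norm_pos_iff.2 hz0
      have hpos : 0 < ‖z‖ * ε / (‖P.S 1‖ + 1) := by positivity
      obtain ⟨f, hf⟩ := exists_norm_sub_smul_lt_of_norm_eq_spectralRadius hz0 hz hzr hpos
      refine ⟨f, ?_⟩
      have h1 : P.S 1 f - z⁻¹ • f = -(z⁻¹ • P.S 1 (P.S (-1) f - z • f)) := by
        rw [map_sub, P.S_S_apply, add_neg_cancel, P.S_zero, map_smul, smul_sub, smul_smul,
          inv_mul_cancel₀ hz0, one_smul, one_apply_eq_self, neg_sub]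
      rw [h1, norm_neg, norm_smul, norm_inv, inv_mul_lt_iff₀ hzn]
      calc _ ≤ ‖P.S 1‖ * ‖P.S (-1) f - z • f‖ := (P.S 1).le_opNorm _
        _ ≤ (‖P.S 1‖ + 1) * ‖P.S (-1) f - z • f‖ := by gcongr; linarith
        _ < (‖P.S 1‖ + 1) * (‖z‖ * ε / (‖P.S 1‖ + 1) * ‖f‖) := by gcongr
        _ = _ := by field_simp
    refine le_trans (le_of_eq ?_) (P.norm_integral_mul_exp_le φ N hN' (inv_ne_zero hz0) happ hre)
    rw [← hzr, ENNReal.coe_toReal, coe_nnnorm]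
    congr 3
    ext t
    congr 2
    linear_combination ((Real.log ‖z‖ : ℂ) * t) * Complex.I_sq
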